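/- arXiv:1211.5959 — 3 statements merged into one kernel-verified Lean document; each statement's English description precedes it below -/
import Mathlib

section
/- Let I be an F_σ P-ideal on ℕ and let E be an equivalence relation on ℕ^ℕ such that K ⊆ E and E is Borel reducible to E_I. Then there is a single E-equivalence class X whose complement ℕ^ℕ \ X belongs to the Laver ideal; in particular X contains all branches of some Laver tree. -/
open Set Filter

/-- The restriction of `x : ℕ → ℕ` to `{0,…,n-1}`, as a finite sequence. -/
def seg (x : ℕ → ℕ) (n : ℕ) : List ℕ := List.ofFn fun i : Fin n => x i

/-- `s` is the stem of the tree `T`: it belongs to `T`, is comparable with every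
element of `T`, and every node of `T` extending it splits infinitely. -/
def IsStemOf (T : Set (List ℕ)) (s : List ℕ) : Prop :=
  s ∈ T ∧ (∀ t ∈ T, t <+: s ∨ s <+: t) ∧
    ∀ t ∈ T, s <+: t → {n : ℕ | t ++ [n] ∈ T}.Infinite

/-- A Laver tree: closed under initial segments, with a stem. -/
def IsLaverTree (T : Set (List ℕ)) : Prop :=
  (∀ s ∈ T, ∀ t : List ℕ, t <+: s → t ∈ T) ∧ ∃ s, IsStemOf T s

/-- `[T]`, the set of branches of `T`. -/
def branches (T : Set (List ℕ)) : Set (ℕ → ℕ) := {x | ∀ n, seg x n ∈ T}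

/-- `S ≤₀ T`: `S` is a Laver tree included in `T` with the same stem. -/
def DirectExt (S T : Set (List ℕ)) : Prop :=
  IsLaverTree S ∧ S ⊆ T ∧ ∃ s, IsStemOf S s ∧ IsStemOf T s

/-- An (proper, containing all finite sets) ideal on ℕ. -/
def IsIdeal (I : Set (Set ℕ)) : Prop :=
  (∀ A : Set ℕ, A.Finite → A ∈ I) ∧ (∀ A B : Set ℕ, A ⊆ B → B ∈ I → A ∈ I) ∧
    (∀ A B : Set ℕ, A ∈ I → B ∈ I → A ∪ B ∈ I) ∧ (Set.univ : Set ℕ) ∉ I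

/-- A P-ideal. -/
def IsPIdeal (I : Set (Set ℕ)) : Prop :=
  ∀ A : ℕ → Set ℕ, (∀ n, A n ∈ I) → ∃ B ∈ I, ∀ n, (A n \ B).Finite

/-- Characteristic function of a subset of ℕ, as a point of the Cantor space. -/
noncomputable def chi (A : Set ℕ) : ℕ → Bool :=
  fun n => @decide (n ∈ A) (Classical.propDecidable _)

/-- An F_σ set: a countable union of closed sets. -/
def IsFsigma {X : Type*} [TopologicalSpace X] (A : Set X) : Prop :=
  ∃ F : ℕ → Set X, (∀ n, IsClosed (F n)) ∧ A = ⋃ n, F n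

/-- An ideal on ℕ is F_σ if its copy in the Cantor space `ℕ → Bool` is F_σ. -/
def FsigmaIdeal (I : Set (Set ℕ)) : Prop := IsFsigma (chi '' I)

/-- The equivalence relation `E_I` on the Cantor space induced by an ideal `I`. -/
def EI (I : Set (Set ℕ)) (x y : ℕ → Bool) : Prop := {n | x n ≠ y n} ∈ I

/-- The generator `A_g` of the Laver ideal. -/
def laverGen (g : List ℕ → ℕ) : Set (ℕ → ℕ) := {f | {n | f n < g (seg f n)}.Infinite}

/-- Membership in the Laver ideal: covered by countably many generators. -/
def InLaverIdeal (A : Set (ℕ → ℕ)) : Prop :=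
  ∃ g : ℕ → List ℕ → ℕ, A ⊆ ⋃ i, laverGen (g i)

/-- The relation `K` on the Baire space. -/
def Krel (x y : ℕ → ℕ) : Prop :=
  ∃ b : ℕ, ∀ n : ℕ, ∃ mx ≤ b, ∃ my ≤ b, x n ≤ y (n + my) ∧ y n ≤ x (n + mx)

/-- `E_{ℓ∞}` on `ℝ^ℕ`: the difference sequence is bounded. -/
def Elinf (x y : ℕ → ℝ) : Prop := ∃ C : ℝ, ∀ n, |x n - y n| ≤ C

/-- A lower semicontinuous submeasure on ℕ. -/
def IsLSCSubmeasure (μ : Set ℕ → ENNReal) : Prop :=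
  μ ∅ = 0 ∧ (∀ A B : Set ℕ, A ⊆ B → μ A ≤ μ B) ∧
    (∀ A B : Set ℕ, μ (A ∪ B) ≤ μ A + μ B) ∧
    ∀ A : Set ℕ, μ A = ⨆ n : ℕ, μ (A ∩ Set.Iio n)

/-- `Exh(μ)`. -/
def Exh (μ : Set ℕ → ENNReal) : Set (Set ℕ) :=
  {A | Filter.Tendsto (fun n : ℕ => μ (A \ Set.Iio n)) Filter.atTop (nhds 0)}

/-- `Fin(μ)`. -/
def FinSub (μ : Set ℕ → ENNReal) : Set (Set ℕ) := {A | μ A < ⊤}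

theorem seg_length (x : ℕ → ℕ) (n : ℕ) : (seg x n).length = n := by simp [seg]

theorem seg_succ (x : ℕ → ℕ) (n : ℕ) : seg x (n + 1) = seg x n ++ [x n] := by
  rw [seg, List.ofFn_succ_last]
  rfl

theorem seg_take (x : ℕ → ℕ) {m n : ℕ} (h : m ≤ n) : (seg x n).take m = seg x m := by
  induction n, h using Nat.le_induction with
  | base => exact List.take_of_length_le (by simp [seg_length])
  | succ n hmn ih => rw [seg_succ, List.take_append_of_le_length (by simpa [seg_length]), ih]

theorem mem_seg (x : ℕ → ℕ) {i n : ℕ} (h : i < n) : x i ∈ seg x n := by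
  simp only [seg, List.mem_ofFn]
  exact ⟨⟨i, h⟩, rfl⟩

/-- If `x` extends `s ++ [i]` then it extends `s` and takes the value `i` next. -/
theorem seg_append_singleton {x : ℕ → ℕ} {s : List ℕ} {i : ℕ}
    (h : seg x (s ++ [i]).length = s ++ [i]) : seg x s.length = s ∧ x s.length = i := by
  rw [List.length_append, List.length_singleton, seg_succ] at h
  have := List.append_inj h (seg_length _ _)
  exact ⟨this.1, by simpa using this.2⟩

theorem seg_seg_length (x : ℕ → ℕ) (n : ℕ) : seg x (seg x n).length = seg x n := by
  rw [seg_length]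

theorem apply_eq_of_seg_eq {x y : ℕ → ℕ} {i n : ℕ} (h : seg x n = seg y n) (hi : i < n) :
    x i = y i := by
  simp only [seg] at h
  exact congrFun (List.ofFn_injective h) ⟨i, hi⟩

/-- A chain of one-step extensions converges to a point of the Baire space. -/
theorem exists_limit_of_chain (S : ℕ → List ℕ) (v : ℕ → ℕ)
    (hS : ∀ k, S (k + 1) = S k ++ [v k]) :
    ∃ x : ℕ → ℕ, ∀ k, seg x ((S 0).length + k) = S k ∧ x ((S 0).length + k) = v k := by
  let x : ℕ → ℕ := fun n =>
    if n < (S 0).length then (S 0).getD n 0 else v (n - (S 0).length)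
  have hv : ∀ k, x ((S 0).length + k) = v k := fun k => by simp [x]
  refine ⟨x, fun k => ⟨?_, hv k⟩⟩
  induction k with
  | zero =>
    apply List.ext_getElem
    · simp [seg_length]
    · intro i h1 h2
      simp [seg, x]
  | succ k ih => rw [← add_assoc, seg_succ, ih, hv, hS]

/-- `A` contains all extensions `x` of `s` such that `x n ∈ h (x ↾ n)` from `s` on, for some
assignment `h` of a set in the filter `u t` to every node `t`. -/
def Big (u : List ℕ → Filter ℕ) (s : List ℕ) (A : Set (ℕ → ℕ)) : Prop :=
  ∃ h : List ℕ → Set ℕ, (∀ t, h t ∈ u t) ∧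
    ∀ x, seg x s.length = s → (∀ n, s.length ≤ n → x n ∈ h (seg x n)) → x ∈ A

section Big

variable {u : List ℕ → Filter ℕ} {s : List ℕ} {A B : Set (ℕ → ℕ)}

theorem Big.of_cone (h : ∀ x, seg x s.length = s → x ∈ A) : Big u s A :=
  ⟨fun _ => univ, fun _ => univ_mem, fun x hx _ => h x hx⟩

theorem Big.mono (h : Big u s A) (hAB : ∀ x, seg x s.length = s → x ∈ A → x ∈ B) : Big u s B := by
  obtain ⟨g, hg, h⟩ := h
  exact ⟨g, hg, fun x hx hn => hAB x hx (h x hx hn)⟩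

theorem Big.inter (hA : Big u s A) (hB : Big u s B) : Big u s (A ∩ B) := by
  obtain ⟨g, hg, h⟩ := hA
  obtain ⟨g', hg', h'⟩ := hB
  exact ⟨fun t => g t ∩ g' t, fun t => inter_mem (hg t) (hg' t), fun x hx hn =>
    ⟨h x hx fun n hs => (hn n hs).1, h' x hx fun n hs => (hn n hs).2⟩⟩

theorem Big.children (h : Big u s A) : ∀ᶠ i in u s, Big u (s ++ [i]) A := by
  obtain ⟨g, hg, h⟩ := h
  filter_upwards [hg s] with i hi
  refine ⟨g, hg, fun x hx hn => ?_⟩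
  obtain ⟨h1, h2⟩ := seg_append_singleton hx
  refine h x h1 fun n hs => ?_
  rcases hs.eq_or_lt with rfl | hs
  · rwa [h1, h2]
  · exact hn n (by simpa using hs)

theorem Big.next {P : ℕ → Prop} (h : ∀ᶠ i in u s, P i) : Big u s {x | P (x s.length)} := by
  classical
  refine ⟨fun t => if t = s then {i | P i} else univ, fun t => ?_, fun x hx hn => ?_⟩
  · dsimp only
    split_ifs with ht
    · subst ht
      exact h
    · exact univ_mem
  · simpa [hx] using hn s.length le_rfl

theorem Big.fusion {A : List ℕ → Set (ℕ → ℕ)} (h : ∀ t, Big u t (A t)) :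
    Big u s {x | ∀ n, s.length ≤ n → x ∈ A (seg x n)} := by
  choose g hg h using h
  refine ⟨fun t => ⋂ k ∈ Finset.range (t.length + 1), g (t.take k) t, fun t => ?_,
    fun x hx hn n hs => ?_⟩
  · exact (biInter_finset_mem _).2 fun k _ => hg _ _
  · refine h _ x (seg_seg_length x n) fun m hm => ?_
    rw [seg_length] at hm
    have := hn m (hs.trans hm)
    simp only [mem_iInter, Finset.mem_range, seg_length] at this
    simpa only [seg_take x hm] using this n (by omega)

theorem Big.fusion_of {W : List ℕ → Prop} {A : List ℕ → Set (ℕ → ℕ)}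
    (hW : ∀ t, W t → ∀ᶠ i in u t, W (t ++ [i])) (hA : ∀ t, W t → Big u t (A t)) (hs : W s) :
    Big u s {x | ∀ n, s.length ≤ n → W (seg x n) ∧ x ∈ A (seg x n)} := by
  have key : ∀ t, Big u t {x | W t → x ∈ A t ∧ W (t ++ [x t.length])} := by
    intro t
    by_cases ht : W t
    · exact ((hA t ht).inter (Big.next (hW t ht))).mono fun x _ hx _ => hx
    · exact Big.of_cone fun x _ h => absurd h ht
  refine (Big.fusion key).mono fun x hx hn => ?_
  have hWn : ∀ n, s.length ≤ n → W (seg x n) := by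
    intro n hsn
    induction n, hsn using Nat.le_induction with
    | base => rwa [hx]
    | succ n hsn ih =>
      have := (hn n hsn ih).2
      rwa [seg_length, ← seg_succ] at this
  exact fun n hsn => ⟨hWn n hsn, (hn n hsn (hWn n hsn)).1⟩

theorem Big.of_children (h : ∀ᶠ i in u s, Big u (s ++ [i]) A) : Big u s A := by
  have key : ∀ t, Big u t {x | Big u t A → x ∈ A} := by
    intro t
    by_cases ht : Big u t A
    · exact ht.mono fun x _ hx _ => hx
    · exact Big.of_cone fun x _ h => absurd h ht
  refine ((Big.fusion (s := s) key).inter (Big.next h)).mono fun x hx hn => ?_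
  refine hn.1 (s.length + 1) (by omega) ?_
  rw [seg_succ, hx]
  exact hn.2

theorem exists_branch {h : List ℕ → Set ℕ} (hh : ∀ t, (h t).Nonempty) (s : List ℕ) :
    ∃ x, seg x s.length = s ∧ ∀ n, s.length ≤ n → x n ∈ h (seg x n) := by
  choose c hc using hh
  let S : ℕ → List ℕ := fun k => (fun t => t ++ [c t])^[k] s
  obtain ⟨x, hx⟩ := exists_limit_of_chain S (fun k => c (S k)) fun k => by
    simp only [S, Function.iterate_succ_apply']
  refine ⟨x, (hx 0).1, fun n hn => ?_⟩
  obtain ⟨k, rfl⟩ := Nat.exists_eq_add_of_le hn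
  change x ((S 0).length + k) ∈ h (seg x ((S 0).length + k))
  rw [(hx k).1, (hx k).2]
  exact hc _

theorem Big.exists [∀ t, (u t).NeBot] (h : Big u s A) : ∃ x ∈ A, seg x s.length = s := by
  obtain ⟨g, hg, h⟩ := h
  obtain ⟨x, hx, hn⟩ := exists_branch (fun t => nonempty_of_mem (hg t)) s
  exact ⟨x, h x hx hn, hx⟩

theorem Big.lengthen [∀ t, (u t).NeBot] (h : Big u s A) (k : ℕ) :
    ∃ t, t.length = s.length + k ∧ Big u t A := by
  induction k with
  | zero => exact ⟨s, rfl, h⟩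
  | succ k ih =>
    obtain ⟨t, ht, hA⟩ := ih
    obtain ⟨i, hi⟩ := hA.children.exists
    exact ⟨t ++ [i], by simp [ht, add_assoc], hi⟩

end Big

/-- Interleaved construction of a `K`-related pair: the states `p k` carry two finite sequences,
`mv` (extended at this step) and `st` (waiting), which exchange their roles at every step. -/
theorem exists_krel_pair {P : Type*} (mv st : P → List ℕ) (R : P → ℕ → P → Prop) (p₀ : P)
    (hlen : (mv p₀).length = (st p₀).length)
    (step : ∀ p m, ∃ i, m ≤ i ∧ ∃ p', R p i p' ∧ mv p' = st p ∧ st p' = mv p ++ [i]) :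
    ∃ (p : ℕ → P) (z : ℕ → ℕ → ℕ), p 0 = p₀ ∧ (∀ k, z (k + 2) = z k) ∧ Krel (z 0) (z 1) ∧
      ∀ k, R (p k) (z k ((mv p₀).length + k / 2)) (p (k + 1)) ∧
        mv (p k) = seg (z k) ((mv p₀).length + k / 2) ∧
        st (p k) = seg (z (k + 1)) ((mv p₀).length + (k + 1) / 2) := by
  choose i hi nx hR hmv hst using fun p => step p ((st p).sum + 1)
  set c := (mv p₀).length with hc
  let p : ℕ → P := fun k => nx^[k] p₀
  have hp : ∀ k, p (k + 1) = nx (p k) := fun k => Function.iterate_succ_apply' _ _ _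
  have hp2 : ∀ k, mv (p (k + 2)) = mv (p k) ++ [i (p k)] := fun k => by
    rw [hp, hmv, hp, hst]
  obtain ⟨x, hx⟩ := exists_limit_of_chain (fun k => mv (p (2 * k))) (fun k => i (p (2 * k)))
    fun k => hp2 (2 * k)
  obtain ⟨y, hy⟩ := exists_limit_of_chain (fun k => mv (p (2 * k + 1)))
    (fun k => i (p (2 * k + 1))) fun k => hp2 (2 * k + 1)
  have hx0 : (mv (p (2 * 0))).length = c := rfl
  have hy0 : (mv (p (2 * 0 + 1))).length = c := by
    change (mv (p (0 + 1))).length = c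
    rw [hp, hmv]
    exact hlen.symm
  simp only [hx0] at hx
  simp only [hy0] at hy
  have big : ∀ (k : ℕ), ∀ a ∈ st (p k), a < i (p k) := fun k a ha =>
    lt_of_lt_of_le (Nat.lt_succ_of_le (List.le_sum_of_mem ha)) (hi (p k))
  have hyx : ∀ k n, n < c + k → y n < x (c + k) := fun k n hn => by
    rw [(hx k).2]
    refine big _ _ ?_
    rw [← hmv, ← hp, (hy k).1.symm]
    exact mem_seg y hn
  have hxy : ∀ k n, n < c + k + 1 → x n < y (c + k) := fun k n hn => by
    rw [(hy k).2]
    refine big _ _ ?_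
    rw [← hmv, ← hp, show 2 * k + 1 + 1 = 2 * (k + 1) by ring, (hx (k + 1)).1.symm]
    exact mem_seg x hn
  let z : ℕ → ℕ → ℕ := fun k => if k % 2 = 0 then x else y
  have hz : ∀ k, z k (c + k / 2) = i (p k) ∧ mv (p k) = seg (z k) (c + k / 2) := by
    intro k
    rcases Nat.even_or_odd' k with ⟨j, rfl | rfl⟩
    · have h1 : 2 * j / 2 = j := by omega
      have h2 : z (2 * j) = x := by simp [z]
      rw [h1, h2]
      exact ⟨(hx j).2, (hx j).1.symm⟩
    · have h1 : (2 * j + 1) / 2 = j := by omega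
      have h2 : z (2 * j + 1) = y := by simp [z, Nat.add_mod]
      rw [h1, h2]
      exact ⟨(hy j).2, (hy j).1.symm⟩
  refine ⟨p, z, rfl, fun k => by simp [z], ?_, fun k => ⟨?_, (hz k).2, ?_⟩⟩
  · refine ⟨c + 1, fun n => ?_⟩
    change ∃ mx ≤ c + 1, ∃ my ≤ c + 1, x n ≤ y (n + my) ∧ y n ≤ x (n + mx)
    rcases lt_or_ge n c with hn | hn
    · refine ⟨c - n, by omega, c - n, by omega, ?_⟩
      rw [show n + (c - n) = c + 0 by omega]
      exact ⟨(hxy 0 n (by omega)).le, (hyx 0 n (by omega)).le⟩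
    · obtain ⟨k, rfl⟩ := Nat.exists_eq_add_of_le hn
      exact ⟨1, by omega, 0, by omega, (hxy k _ (by omega)).le, (hyx (k + 1) _ (by omega)).le⟩
  · rw [(hz k).1, hp]
    exact hR _
  · rw [← hmv, ← hp]
    exact (hz (k + 1)).2

/-- Two big sets contain `K`-related points, even for different stems and filters. -/
theorem Big.exists_krel {u v : List ℕ → Filter ℕ} [∀ t, (u t).NeBot] [∀ t, (v t).NeBot]
    (hu : ∀ t, u t ≤ atTop) (hv : ∀ t, v t ≤ atTop) {s t : List ℕ} {A B : Set (ℕ → ℕ)}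
    (hA : Big u s A) (hB : Big v t B) : ∃ x ∈ A, ∃ y ∈ B, Krel x y := by
  obtain ⟨s', hs', g, hg, hA⟩ := hA.lengthen t.length
  obtain ⟨t', ht', g', hg', hB⟩ := hB.lengthen s.length
  have hlen : s'.length = t'.length := by omega
  have inf : ∀ (b : Bool) (r : List ℕ) (m : ℕ), ∃ i, m ≤ i ∧ i ∈ (bif b then g else g') r := by
    intro b r m
    cases b
    · exact Filter.nonempty_of_mem (inter_mem (hv r (Ici_mem_atTop m)) (hg' r))
    · exact Filter.nonempty_of_mem (inter_mem (hu r (Ici_mem_atTop m)) (hg r))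
  obtain ⟨p, z, hp0, hz, hK, hp⟩ := exists_krel_pair (P := Bool × List ℕ × List ℕ)
    (fun p => p.2.1) (fun p => p.2.2)
    (fun p i p' => p'.1 = !p.1 ∧ i ∈ (bif p.1 then g else g') p.2.1) (true, s', t') hlen
    (fun p m => by
      obtain ⟨i, hm, hi⟩ := inf p.1 p.2.1 m
      exact ⟨i, hm, (!p.1, p.2.2, p.2.1 ++ [i]), ⟨rfl, hi⟩, rfl, rfl⟩)
  dsimp only at hp
  have hpar : ∀ k, (p (2 * k)).1 = true ∧ z (2 * k) = z 0 ∧ z (2 * k + 1) = z 1 := by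
    intro k
    induction k with
    | zero => exact ⟨by simp [hp0], rfl, rfl⟩
    | succ k ih =>
      refine ⟨?_, (hz (2 * k)).trans ih.2.1, (hz (2 * k + 1)).trans ih.2.2⟩
      have h1 := (hp (2 * k)).1.1
      have h2 := (hp (2 * k + 1)).1.1
      rw [show 2 * (k + 1) = 2 * k + 1 + 1 by ring, h2, h1, ih.1]
      rfl
  refine ⟨z 0, hA _ ?_ fun n hn => ?_, z 1, hB _ ?_ fun n hn => ?_, hK⟩
  · have := (hp 0).2.1
    rw [hp0] at this
    exact this.symm
  · obtain ⟨k, rfl⟩ := Nat.exists_eq_add_of_le hn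
    have := hp (2 * k)
    rw [(hpar k).1, (hpar k).2.1, show 2 * k / 2 = k by omega] at this
    rw [← this.2.1]
    exact this.1.2
  · have := (hp 0).2.2
    rw [hp0] at this
    rw [← hlen]
    exact this.symm
  · obtain ⟨k, rfl⟩ := Nat.exists_eq_add_of_le hn
    have := hp (2 * k + 1)
    rw [(hp (2 * k)).1.1, (hpar k).1, (hpar k).2.2, show (2 * k + 1) / 2 = k by omega] at this
    rw [← hlen, ← this.2.1]
    exact this.1.2

/-- `Big` with respect to the cofinite filter at every node. -/
abbrev CoBig : List ℕ → Set (ℕ → ℕ) → Prop := Big fun _ => atTop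

theorem inLaverIdeal_of_coBig_compl {A : Set (ℕ → ℕ)} (h : ∀ s, CoBig s Aᶜ) :
    InLaverIdeal A := by
  choose g hg h using h
  choose b hb using fun s t => mem_atTop_sets.1 (hg s t)
  refine ⟨fun _ t => ∑ k ∈ Finset.range (t.length + 1), b (t.take k) t, fun x hxA => ?_⟩
  refine mem_iUnion.2 ⟨0, fun hfin => ?_⟩
  obtain ⟨N, hN⟩ := hfin.bddAbove
  refine h (seg x (N + 1)) x (seg_seg_length _ _) (fun n hn => ?_) hxA
  rw [seg_length] at hn
  refine hb _ _ _ (le_trans ?_ (not_lt.1 fun hlt => absurd (hN hlt) (by omega)))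
  rw [← seg_take x hn]
  exact Finset.single_le_sum (f := fun k => b ((seg x n).take k) (seg x n))
    (fun _ _ => Nat.zero_le _) (Finset.mem_range.2 (by rw [seg_length]; omega))

theorem exists_laverTree_of_coBig {A : Set (ℕ → ℕ)} (h : CoBig [] A) :
    ∃ T, IsLaverTree T ∧ branches T ⊆ A := by
  obtain ⟨g, hg, h⟩ := h
  let T : Set (List ℕ) := {t | ∀ r i, r ++ [i] <+: t → i ∈ g r}
  refine ⟨T, ⟨fun s hs t hts r i hr => hs r i (hr.trans hts), [], ?_, ?_, ?_⟩, fun x hx => ?_⟩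
  · intro r i hr
    simp at hr
  · exact fun t _ => Or.inr ⟨t, rfl⟩
  · intro t ht _
    refine ((Nat.frequently_atTop_iff_infinite (p := (· ∈ g t))).1
      (Filter.Eventually.frequently (hg t))).mono fun n hn r i hr => ?_
    rcases List.prefix_concat_iff.1 hr with h1 | h1
    · obtain ⟨rfl, h2⟩ := List.append_inj' h1 rfl
      obtain rfl : i = n := by simpa using h2
      exact hn
    · exact ht r i h1
  · refine h x rfl fun n _ => hx (n + 1) _ _ ?_
    rw [seg_succ]

section Dichotomy

variable (q : (ℕ → ℕ) → ℕ → ℕ)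

/-- The nodes `t` and `r` such that the image under `q` of the cone of `r` is not negligible
below `t`. -/
def Positive (t r : List ℕ) : Prop := ¬ CoBig t (q '' {w | seg w r.length = r})ᶜ

/-- There is a tree above `t` with infinite splitting everywhere, each of whose branches passes
through a proper extension of `t` at which some one-step extension of `r` is positive. -/
def Reaches (r t : List ℕ) : Prop :=
  ∃ g : List ℕ → Set ℕ, (∀ t, (g t).Infinite) ∧ ∀ x, seg x t.length = t →
    (∀ n, t.length ≤ n → x n ∈ g (seg x n)) →
      ∃ n, t.length < n ∧ ∃ k, Positive q (seg x n) (r ++ [k])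

variable {q}

theorem Reaches.of_frequently {r t : List ℕ}
    (h : ∃ᶠ i in atTop, (∃ k, Positive q (t ++ [i]) (r ++ [k])) ∨ Reaches q r (t ++ [i])) :
    Reaches q r t := by
  classical
  have H : ∀ i, ∃ g : List ℕ → Set ℕ, (∀ t, (g t).Infinite) ∧ (Reaches q r (t ++ [i]) →
      ∀ x, seg x (t ++ [i]).length = t ++ [i] →
        (∀ n, (t ++ [i]).length ≤ n → x n ∈ g (seg x n)) →
          ∃ n, (t ++ [i]).length < n ∧ ∃ k, Positive q (seg x n) (r ++ [k])) := fun i => by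
    by_cases hi : Reaches q r (t ++ [i])
    · obtain ⟨g, hg, h⟩ := hi
      exact ⟨g, hg, fun _ => h⟩
    · exact ⟨fun _ => univ, fun _ => infinite_univ, fun h => absurd h hi⟩
  choose G hG hx using H
  refine ⟨fun t' => if t' = t then
    {i | (∃ k, Positive q (t ++ [i]) (r ++ [k])) ∨ Reaches q r (t ++ [i])}
    else G (t'.getD t.length 0) t', fun t' => ?_, fun x hxt hn => ?_⟩
  · dsimp only
    split_ifs
    · exact Nat.frequently_atTop_iff_infinite.1 h
    · exact hG _ _
  · have hxt' : seg x (t ++ [x t.length]).length = t ++ [x t.length] := by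
      rw [List.length_append, List.length_singleton, seg_succ, hxt]
    have h0 := hn t.length le_rfl
    rw [hxt] at h0
    simp only [if_true] at h0
    rcases h0 with h0 | h0
    · refine ⟨t.length + 1, by omega, ?_⟩
      rwa [seg_succ, hxt]
    · have tail : ∀ n, (t ++ [x t.length]).length ≤ n → x n ∈ G (x t.length) (seg x n) := by
        intro n hn'
        rw [List.length_append, List.length_singleton] at hn'
        have hne : seg x n ≠ t := fun h => by
          have := congrArg List.length h
          rw [seg_length] at this
          omega
        have := hn n (by omega)
        have hget : (seg x n).getD t.length 0 = x t.length := by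
          simp [seg, List.getD_eq_getElem?_getD,
            show t.length < n by omega]
        simp only [if_neg hne, hget] at this
        exact this
      obtain ⟨n, hn, hk⟩ := hx _ h0 x hxt' tail
      exact ⟨n, lt_trans (by simp) hn, hk⟩

theorem Positive.reaches {t r : List ℕ} (h : Positive q t r) : Reaches q r t := by
  by_contra hR
  refine h ?_
  have next : ∀ t, ¬ Reaches q r t → ∀ᶠ i in atTop,
      ¬ ((∃ k, Positive q (t ++ [i]) (r ++ [k])) ∨ Reaches q r (t ++ [i])) := fun t ht => by
    by_contra hcon
    exact ht (.of_frequently (by rwa [Filter.Frequently]))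
  have small : ∀ t, ¬ Reaches q r t → ∀ k,
      CoBig t (q '' {w | seg w (r ++ [k]).length = r ++ [k]})ᶜ := fun t ht k =>
    Big.of_children <| (next t ht).mono fun i hi => by
      by_contra hcon
      exact hi (Or.inl ⟨k, hcon⟩)
  have key : ∀ t, ∀ m, ¬ Reaches q r t →
      CoBig t {x | ∀ k ≤ m, x ∉ q '' {w | seg w (r ++ [k]).length = r ++ [k]}} := by
    intro t m ht
    induction m with
    | zero => exact (small t ht 0).mono fun x _ hx k hk => by rwa [Nat.le_zero.1 hk]
    | succ m ih =>
      refine (ih.inter (small t ht (m + 1))).mono fun x _ hx k hk => ?_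
      rcases hk.lt_or_eq with hk | rfl
      · exact hx.1 k (by omega)
      · exact hx.2
  refine (Big.fusion_of (fun t ht => (next t ht).mono fun i hi h => hi (Or.inr h))
    (fun t ht => key t t.length ht) hR).mono ?_
  rintro x - hx ⟨w, hw, rfl⟩
  refine (hx (max t.length (w r.length)) (le_max_left _ _)).2 (w r.length) ?_ ⟨w, ?_, rfl⟩
  · rw [seg_length]
    exact le_max_right _ _
  · change seg w _ = _
    rw [List.length_append, List.length_singleton, seg_succ, hw]

theorem Positive.exists_point {t r : List ℕ} (h : Positive q t r) :
    ∃ w, seg w r.length = r ∧ seg (q w) t.length = t := by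
  by_contra! hcon
  exact h (Big.of_cone fun x hx => by
    rintro ⟨w, hw, rfl⟩
    exact hcon w hw hx)

theorem tendsto_of_seg_eq {w : ℕ → ℕ → ℕ} {z : ℕ → ℕ} (n : ℕ → ℕ) (hn : ∀ j, j ≤ n j)
    (h : ∀ j, seg (w j) (n j) = seg z (n j)) : Tendsto w atTop (nhds z) := by
  refine tendsto_pi_nhds.2 fun i => tendsto_const_nhds.congr' ?_
  filter_upwards [eventually_gt_atTop i] with j hj
  exact (apply_eq_of_seg_eq (h j) (hj.trans_le (hn j))).symm

/-- If the range of a continuous function is not negligible below `s`, then it contains all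
branches of a tree with stem `s` and infinite splitting. -/
theorem Positive.exists_tree (hq : Continuous q) {s : List ℕ} (hs : Positive q s []) :
    ∃ g : List ℕ → Set ℕ, (∀ t, (g t).Infinite) ∧ ∀ x, seg x s.length = s →
      (∀ n, s.length ≤ n → x n ∈ g (seg x n)) → x ∈ range q := by
  classical
  have H : ∀ r t, ∃ g : List ℕ → Set ℕ, (∀ t, (g t).Infinite) ∧ (Positive q t r →
      ∀ x, seg x t.length = t → (∀ n, t.length ≤ n → x n ∈ g (seg x n)) →
        ∃ n, t.length < n ∧ ∃ k, Positive q (seg x n) (r ++ [k])) := fun r t => by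
    by_cases h : Positive q t r
    · obtain ⟨g, hg, h'⟩ := h.reaches
      exact ⟨g, hg, fun _ => h'⟩
    · exact ⟨fun _ => univ, fun _ => infinite_univ, fun h' => absurd h' h⟩
  choose G hG hx using H
  let next : List ℕ × List ℕ × List ℕ → ℕ → List ℕ × List ℕ × List ℕ := fun m i =>
    if h : ∃ k, Positive q (m.1 ++ [i]) (m.2.2 ++ [k]) then
      (m.1 ++ [i], m.1 ++ [i], m.2.2 ++ [h.choose]) else (m.1 ++ [i], m.2)
  let mem : List ℕ → List ℕ × List ℕ × List ℕ := fun t =>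
    (t.drop s.length).foldl next (s, s, [])
  refine ⟨fun t => G (mem t).2.2 (mem t).2.1 t, fun t => hG _ _ _, fun x hxs hxn => ?_⟩
  have mem_succ : ∀ n, s.length ≤ n → mem (seg x (n + 1)) = next (mem (seg x n)) (x n) := by
    intro n hn
    simp only [mem]
    rw [seg_succ, List.drop_append_of_le_length (by rwa [seg_length]), List.foldl_append]
    rfl
  let P : ℕ × List ℕ → Prop := fun p => s.length ≤ p.1 ∧ Positive q (seg x p.1) p.2 ∧
    mem (seg x p.1) = (seg x p.1, seg x p.1, p.2)
  have progress : ∀ p, P p → ∃ p' : ℕ × List ℕ, P p' ∧ p.1 < p'.1 ∧ ∃ k, p'.2 = p.2 ++ [k] := by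
    rintro ⟨n₀, r⟩ ⟨hn₀, hpos, hmem⟩
    dsimp only at hn₀ hpos hmem ⊢
    have stay : ∀ n, n₀ ≤ n →
        (∀ n', n₀ < n' → n' ≤ n → ¬ ∃ k, Positive q (seg x n') (r ++ [k])) →
        mem (seg x n) = (seg x n, seg x n₀, r) := by
      intro n hn
      induction n, hn using Nat.le_induction with
      | base => exact fun _ => hmem
      | succ n hn ih =>
        intro hno
        rw [mem_succ n (hn₀.trans hn), ih fun n' h1 h2 => hno n' h1 (by omega)]
        have := hno (n + 1) (by omega) le_rfl
        rw [seg_succ] at this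
        simp only [next, dif_neg this]
        rw [seg_succ]
    have hit : ∃ n, n₀ < n ∧ ∃ k, Positive q (seg x n) (r ++ [k]) := by
      by_contra hno
      have hno' : ∀ n', n₀ < n' → ¬ ∃ k, Positive q (seg x n') (r ++ [k]) := fun n' h1 h2 =>
        hno ⟨n', h1, h2⟩
      obtain ⟨n, h1, h2⟩ := hx r (seg x n₀) hpos x (seg_seg_length _ _) fun n hn => by
        rw [seg_length] at hn
        have := hxn n (hn₀.trans hn)
        simp only [stay n hn fun n' h1 _ => hno' n' h1] at this
        exact this
      rw [seg_length] at h1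
      exact hno ⟨n, h1, h2⟩
    obtain ⟨hlt, hk⟩ := Nat.find_spec hit
    have hmin := fun m => Nat.find_min hit (m := m)
    generalize Nat.find hit = n at hlt hk hmin
    obtain ⟨n, rfl⟩ : ∃ m, n = m + 1 := ⟨n - 1, by omega⟩
    have hst := stay n (by omega) fun n' h1 h2 h3 => hmin n' (by omega) ⟨h1, h3⟩
    have hm := mem_succ n (by omega)
    rw [seg_succ] at hk
    simp only [hst, next] at hm
    rw [dif_pos hk] at hm
    refine ⟨(n + 1, r ++ [hk.choose]), ⟨by dsimp only; omega, ?_, ?_⟩, hlt, _, rfl⟩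
    · dsimp only
      rw [seg_succ]
      exact hk.choose_spec
    · dsimp only
      rw [hm, seg_succ]
  have hP0 : P (s.length, []) := by
    refine ⟨le_rfl, by rwa [hxs], ?_⟩
    dsimp only
    rw [hxs]
    simp [mem]
  choose! nx hnx hlt k hk using progress
  let p : ℕ → ℕ × List ℕ := fun j => nx^[j] (s.length, [])
  have hp : ∀ j, p (j + 1) = nx (p j) := fun j => Function.iterate_succ_apply' _ _ _
  have hPp : ∀ j, P (p j) := fun j => by
    induction j with
    | zero => exact hP0
    | succ j ih => rw [hp]; exact hnx _ ih
  have hpj : ∀ j, j ≤ (p j).1 := fun j => by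
    induction j with
    | zero => exact Nat.zero_le _
    | succ j ih => rw [hp]; exact lt_of_le_of_lt ih (hlt _ (hPp j))
  obtain ⟨z, hz⟩ := exists_limit_of_chain (fun j => (p j).2) (fun j => k (p j)) fun j => by
    rw [hp, hk _ (hPp j)]
  have hz' : ∀ j, seg z j = (p j).2 := fun j => by
    have := (hz j).1
    change seg z (0 + j) = _ at this
    rwa [zero_add] at this
  choose w hw hqw using fun j => (hPp j).2.1.exists_point
  have hwz : Tendsto w atTop (nhds z) := tendsto_of_seg_eq id (fun _ => le_rfl) fun j => by
    have := hw j
    rwa [← hz', seg_length] at this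
  have hqx : Tendsto (q ∘ w) atTop (nhds x) := tendsto_of_seg_eq (fun j => (p j).1) hpj fun j => by
    have := hqw j
    rwa [seg_length] at this
  exact ⟨z, tendsto_nhds_unique ((hq.tendsto z).comp hwz) hqx⟩

end Dichotomy

/-- A Borel set that is not negligible below `s` with respect to the cofinite filter is big below
`s` for suitable filters at the nodes. -/
theorem exists_big_of_not_coBig_compl {A : Set (ℕ → ℕ)} (hA : MeasurableSet A) {s : List ℕ}
    (h : ¬ CoBig s Aᶜ) :
    ∃ u : List ℕ → Filter ℕ, (∀ t, (u t).NeBot) ∧ (∀ t, u t ≤ atTop) ∧ Big u s A := by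
  have han := hA.analyticSet
  rw [MeasureTheory.AnalyticSet] at han
  rcases han with rfl | ⟨q, hq, rfl⟩
  · exact absurd (Big.of_cone fun x _ => by simp) h
  · have hpos : Positive q s [] := fun hs => h (hs.mono fun x _ hx ⟨w, hw⟩ => hx ⟨w, rfl, hw⟩)
    obtain ⟨g, hg, hgx⟩ := hpos.exists_tree hq
    refine ⟨fun t => atTop ⊓ 𝓟 (g t), fun t => ?_, fun t => inf_le_left, g, fun t => ?_, hgx⟩
    · exact frequently_mem_iff_neBot.1 (Nat.frequently_atTop_iff_infinite.2 (hg t))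
    · exact mem_inf_of_right (mem_principal_self _)

/-- `Big` with respect to a fixed nonprincipal ultrafilter at every node. -/
abbrev UBig : List ℕ → Set (ℕ → ℕ) → Prop := Big fun _ => (hyperfilter ℕ : Filter ℕ)

theorem uBig_or_uBig_compl_of_children {s : List ℕ} {A : Set (ℕ → ℕ)}
    (h : ∀ i, UBig (s ++ [i]) A ∨ UBig (s ++ [i]) Aᶜ) : UBig s A ∨ UBig s Aᶜ := by
  by_cases hA : ∀ᶠ i in (hyperfilter ℕ : Filter ℕ), UBig (s ++ [i]) A
  · exact Or.inl (Big.of_children hA)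
  · refine Or.inr (Big.of_children ?_)
    exact (Ultrafilter.eventually_not.2 hA).mono fun i hi => (h i).resolve_left hi

theorem uBig_or_uBig_compl {A : Set (ℕ → ℕ)} (hA : MeasurableSet A) (s : List ℕ) :
    UBig s A ∨ UBig s Aᶜ := by
  let m : MeasurableSpace (ℕ → ℕ) :=
    { MeasurableSet' := fun A => ∀ s, UBig s A ∨ UBig s Aᶜ
      measurableSet_empty := fun s => Or.inr (Big.of_cone fun x _ => by simp)
      measurableSet_compl := fun A hA s => by
        rw [compl_compl]
        exact (hA s).symm
      measurableSet_iUnion := fun A hA s => by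
        by_contra! hs
        refine hs.2 ?_
        have hW : ∀ t, ¬ UBig t (⋃ n, A n) →
            ∀ᶠ i in (hyperfilter ℕ : Filter ℕ), ¬ UBig (t ++ [i]) (⋃ n, A n) := fun t ht =>
          Ultrafilter.eventually_not.2 fun h => ht (Big.of_children h)
        have hn : ∀ t n, ¬ UBig t (⋃ n, A n) → UBig t (A n)ᶜ := fun t n ht =>
          (hA n t).resolve_left fun h => ht (h.mono fun x _ hx => mem_iUnion.2 ⟨n, hx⟩)
        have hm : ∀ t m, ¬ UBig t (⋃ n, A n) → UBig t {x | ∀ k ≤ m, x ∉ A k} := by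
          intro t m ht
          induction m with
          | zero => exact (hn t 0 ht).mono fun x _ hx k hk => by rwa [Nat.le_zero.1 hk]
          | succ m ih =>
            refine (ih.inter (hn t (m + 1) ht)).mono fun x _ hx k hk => ?_
            rcases hk.lt_or_eq with hk | rfl
            · exact hx.1 k (by omega)
            · exact hx.2
        refine (Big.fusion_of hW (fun t ht => hm t t.length ht) hs.1).mono fun x _ hx hxA => ?_
        obtain ⟨k, hk⟩ := mem_iUnion.1 hxA
        refine (hx (max s.length k) (le_max_left _ _)).2 k ?_ hk
        rw [seg_length]
        exact le_max_right _ _ }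
  have hle : (MeasurableSpace.pi : MeasurableSpace (ℕ → ℕ)) ≤ m := by
    refine iSup_le fun i => ?_
    rintro _ ⟨V, -, rfl⟩
    have decided : ∀ t : List ℕ, i < t.length → UBig t ((fun x => x i) ⁻¹' V) ∨
        UBig t ((fun x => x i) ⁻¹' V)ᶜ := fun t ht => by
      by_cases hV : t[i] ∈ V
      · refine Or.inl (Big.of_cone fun x hx => ?_)
        have : t[i] = x i := by
          conv_lhs => rw [List.getElem_of_eq hx.symm ht]
          simp [seg]
        change x i ∈ V
        rwa [← this]
      · refine Or.inr (Big.of_cone fun x hx => ?_)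
        have : t[i] = x i := by
          conv_lhs => rw [List.getElem_of_eq hx.symm ht]
          simp [seg]
        change x i ∉ V
        rwa [← this]
    have all : ∀ d (t : List ℕ), i < t.length + d → UBig t ((fun x => x i) ⁻¹' V) ∨
        UBig t ((fun x => x i) ⁻¹' V)ᶜ := fun d => by
      induction d with
      | zero => exact decided
      | succ d ih =>
        exact fun t ht => uBig_or_uBig_compl_of_children fun j => ih _ (by simp; omega)
    exact fun s => all (i + 1) s (by omega)
  exact hle A hA s

theorem uBig_exists_node_or (D : List ℕ → Prop) (s : List ℕ) :
    UBig s {x | ∃ n, s.length ≤ n ∧ D (seg x n)} ∨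
      UBig s {x | ∀ n, s.length ≤ n → ¬ D (seg x n)} := by
  by_contra! hs
  refine hs.2 ?_
  let W : List ℕ → Prop := fun t => ¬ UBig t {x | ∃ n, t.length ≤ n ∧ D (seg x n)}
  have hW : ∀ t, W t → ∀ᶠ i in (hyperfilter ℕ : Filter ℕ), W (t ++ [i]) := fun t ht =>
    Ultrafilter.eventually_not.2 fun h => ht <| Big.of_children <| h.mono fun i hi =>
      hi.mono fun x _ ⟨n, hn, hx⟩ => ⟨n, le_trans (by simp) hn, hx⟩
  refine (Big.fusion_of (A := fun _ => univ) hW (fun t _ => Big.of_cone fun _ _ => trivial)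
    hs.1).mono fun x _ hx n hn hD => ?_
  refine (hx n hn).1 (Big.of_cone fun y hy => ⟨_, le_rfl, ?_⟩)
  rwa [hy]

/-- The value of `f` forced at the node `s`. -/
noncomputable def forced (f : (ℕ → ℕ) → ℕ → Bool) (s : List ℕ) : ℕ → Bool :=
  chi {n | UBig s {x | f x n = true}}

theorem uBig_eq_forced {f : (ℕ → ℕ) → ℕ → Bool} (hf : Measurable f) (s : List ℕ) (n : ℕ) :
    UBig s {x | f x n = forced f s n} := by
  have hm : MeasurableSet {x | f x n = true} :=
    measurableSet_eq_fun ((measurable_pi_apply n).comp hf) measurable_const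
  by_cases h : UBig s {x | f x n = true}
  · simp [forced, chi, h]
  · simpa [forced, chi, h, compl_ofPred] using (uBig_or_uBig_compl hm s).resolve_left h

theorem uBig_forall_lt_eq_forced {f : (ℕ → ℕ) → ℕ → Bool} (hf : Measurable f) (s : List ℕ)
    (N : ℕ) : UBig s {x | ∀ n < N, f x n = forced f s n} := by
  induction N with
  | zero => exact Big.of_cone fun x _ n hn => absurd hn (Nat.not_lt_zero n)
  | succ N ih =>
    refine (ih.inter (uBig_eq_forced hf s N)).mono fun x _ hx n hn => ?_
    rcases (Nat.lt_succ_iff.1 hn).lt_or_eq with hn | rfl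
    · exact hx.1 n hn
    · exact hx.2

theorem eventually_forced_eq {f : (ℕ → ℕ) → ℕ → Bool} (hf : Measurable f) (s : List ℕ) (N : ℕ) :
    ∀ᶠ i in (hyperfilter ℕ : Filter ℕ), ∀ n < N, forced f (s ++ [i]) n = forced f s n := by
  filter_upwards [(uBig_forall_lt_eq_forced hf s N).children] with i hi n hn
  obtain ⟨x, ⟨h1, h2⟩, -⟩ := (hi.inter (uBig_forall_lt_eq_forced hf (s ++ [i]) N)).exists
  rw [← h1 n hn, h2 n hn]

theorem uBig_limit_forced {f : (ℕ → ℕ) → ℕ → Bool} (hf : Measurable f) (s : List ℕ) :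
    UBig s {x | ∀ m, s.length ≤ m → ∀ n < m, f x n = forced f (seg x m) n} := by
  refine (Big.fusion fun t => uBig_forall_lt_eq_forced hf t t.length).mono fun x _ hx m hm n hn => ?_
  exact hx m hm n (by rwa [seg_length])

/-- Interleaved construction of a `K`-related pair inside a big set, keeping control of `f`:
up to `N (k + 1)`, the value of `f` at the point waiting at step `k` is the forced one. -/
theorem exists_krel_pair_forced {f : (ℕ → ℕ) → ℕ → Bool} (hf : Measurable f) {r : List ℕ}
    {A : Set (ℕ → ℕ)} (hA : UBig r A) (Inv : List ℕ → List ℕ → ℕ → Prop)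
    (R : ℕ → List ℕ → List ℕ → ℕ → ℕ → ℕ → Prop) (h0 : Inv r r 0)
    (step : ∀ k s t N, Inv s t N → ∀ᶠ i in (hyperfilter ℕ : Filter ℕ),
      ∃ N', N < N' ∧ Inv t (s ++ [i]) N' ∧ R k s t N i N') :
    ∃ (z : ℕ → ℕ → ℕ) (N : ℕ → ℕ), (∀ k, z (k + 2) = z k) ∧ Krel (z 0) (z 1) ∧ StrictMono N ∧
      N 0 = 0 ∧ z 0 ∈ A ∧
      (∀ k, Inv (seg (z k) (r.length + k / 2)) (seg (z (k + 1)) (r.length + (k + 1) / 2)) (N k)) ∧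
      (∀ k, R k (seg (z k) (r.length + k / 2)) (seg (z (k + 1)) (r.length + (k + 1) / 2)) (N k)
        (z k (r.length + k / 2)) (N (k + 1))) ∧
      ∀ k, ∀ n < N (k + 1),
        f (z (k + 1)) n = forced f (seg (z (k + 1)) (r.length + (k + 1) / 2)) n := by
  obtain ⟨h, hh, hhx⟩ := hA.inter (uBig_limit_forced hf r)
  let P := {p : List ℕ × List ℕ × ℕ × ℕ // Inv p.1 p.2.1 p.2.2.1}
  obtain ⟨p, z, hp0, hz, hK, hp⟩ := exists_krel_pair (P := P) (fun p => p.1.1) (fun p => p.1.2.1)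
    (fun p i p' => p.1.2.2.1 < p'.1.2.2.1 ∧ p'.1.2.2.2 = p.1.2.2.2 + 1 ∧ i ∈ h p.1.1 ∧
      (∀ n < p.1.2.2.1, forced f (p.1.1 ++ [i]) n = forced f p.1.1 n) ∧
      R p.1.2.2.2 p.1.1 p.1.2.1 p.1.2.2.1 i p'.1.2.2.1) ⟨(r, r, 0, 0), h0⟩ rfl
    (by
      rintro ⟨⟨s, t, N, k⟩, hI⟩ m
      obtain ⟨i, ⟨⟨⟨N', hN, hI', hR⟩, hm⟩, hi⟩, hagree⟩ :=
        ((((step k s t N hI).and (Nat.hyperfilter_le_atTop (eventually_ge_atTop m))).and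
          (hh s)).and (eventually_forced_eq hf s N)).exists
      exact ⟨i, hm, ⟨(t, s ++ [i], N', k + 1), hI'⟩, ⟨hN, rfl, hi, hagree, hR⟩, rfl, rfl⟩)
  dsimp only at hp
  set N : ℕ → ℕ := fun k => (p k).1.2.2.1 with hN
  have hNmono : StrictMono N := strictMono_nat_of_lt_succ fun k => (hp k).1.1
  have hcount : ∀ k, (p k).1.2.2.2 = k := fun k => by
    induction k with
    | zero => rw [hp0]
    | succ k ih => rw [(hp k).1.2.1, ih]
  have hzj : ∀ k j, z (k + 2 * j) = z k := fun k j => by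
    induction j with
    | zero => rfl
    | succ j ih => rw [show k + 2 * (j + 1) = k + 2 * j + 2 by ring, hz, ih]
  have hzA : ∀ k, z k ∈ A ∩ {x | ∀ m, r.length ≤ m → ∀ n < m, f x n = forced f (seg x m) n} := by
    have key : ∀ k < 2, z k ∈ A ∩
        {x | ∀ m, r.length ≤ m → ∀ n < m, f x n = forced f (seg x m) n} := by
      intro k hk
      refine hhx _ ?_ fun n hn => ?_
      · have h1 := (hp 0).2.1
        have h2 := (hp 0).2.2
        rw [hp0] at h1 h2
        interval_cases k
        · exact h1.symm
        · exact h2.symm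
      · obtain ⟨j, rfl⟩ := Nat.exists_eq_add_of_le hn
        have := hp (k + 2 * j)
        rw [hzj, show (k + 2 * j) / 2 = j by omega] at this
        rw [← this.2.1]
        exact this.1.2.2.1
    intro k
    rw [show k = k % 2 + 2 * (k / 2) by omega, hzj]
    exact key _ (Nat.mod_lt _ (by norm_num))
  refine ⟨z, N, hz, hK, hNmono, by simp [hN, hp0], (hzA 0).1, fun k => ?_, fun k => ?_, ?_⟩
  · rw [← (hp k).2.1, ← (hp k).2.2]
    exact (p k).2
  · have := (hp k).1.2.2.2.2
    rwa [hcount, (hp k).2.1, (hp k).2.2] at this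
  · intro k n hn
    have stable : ∀ j, forced f (seg (z (k + 1)) (r.length + (k + 1) / 2 + j)) n =
        forced f (seg (z (k + 1)) (r.length + (k + 1) / 2)) n := fun j => by
      induction j with
      | zero => rfl
      | succ j ih =>
        rw [← ih]
        have := hp (k + 1 + 2 * j)
        have hlt : n < (p (k + 1 + 2 * j)).1.2.2.1 :=
          hn.trans_le (hNmono.monotone (by omega))
        have := this.1.2.2.2.1 n hlt
        rw [(hp (k + 1 + 2 * j)).2.1, hzj, ← seg_succ,
          show (k + 1 + 2 * j) / 2 = (k + 1) / 2 + j by omega, ← add_assoc] at this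
        exact this
    rw [← stable (n + 1)]
    exact (hzA (k + 1)).2 _ (by omega) n (by omega)

section Ideal

variable {I : Set (Set ℕ)}

theorem chi_mem_image_iff {A : Set ℕ} : chi A ∈ chi '' I ↔ A ∈ I := by
  have inj : Function.Injective chi := fun A B h => by
    ext n
    simpa [chi] using congrFun h n
  exact inj.mem_set_image

theorem chi_ne (x y : ℕ → Bool) : chi {n | x n ≠ y n} = fun n => xor (x n) (y n) := by
  funext n
  cases hx : x n <;> cases hy : y n <;> simp [chi, hx, hy]

theorem eI_iff_xor_mem (x y : ℕ → Bool) :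
    EI I x y ↔ (fun n => xor (x n) (y n)) ∈ chi '' I := by
  rw [EI, ← chi_mem_image_iff, chi_ne]

theorem EI.refl (hI : IsIdeal I) (x : ℕ → Bool) : EI I x x := hI.1 _ (by simp)

theorem EI.symm {x y : ℕ → Bool} (h : EI I x y) : EI I y x := by
  simpa only [EI, ne_comm] using h

theorem EI.trans (hI : IsIdeal I) {x y z : ℕ → Bool} (hxy : EI I x y) (hyz : EI I y z) :
    EI I x z := by
  refine hI.2.1 _ _ (fun n hn => ?_) (hI.2.2.1 _ _ hxy hyz)
  by_contra hcon
  simp only [mem_union, mem_ofPred_eq, not_or, not_not] at hcon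
  exact hn (hcon.1.trans hcon.2)

theorem measurableSet_eI (hF : FsigmaIdeal I) {f : (ℕ → ℕ) → ℕ → Bool} (hf : Measurable f)
    (c : ℕ → Bool) : MeasurableSet {x | EI I (f x) c} := by
  obtain ⟨F, hFc, hF⟩ := hF
  have hm : MeasurableSet (chi '' I) := by
    rw [hF]
    exact MeasurableSet.iUnion fun n => (hFc n).measurableSet
  have hx : Measurable fun x n => xor (f x n) (c n) := by
    refine measurable_pi_lambda _ fun n => ?_
    exact (measurable_from_top (f := fun b => xor b (c n))).comp ((measurable_pi_apply n).comp hf)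
  have : {x | EI I (f x) c} = (fun x n => xor (f x n) (c n)) ⁻¹' (chi '' I) := by
    ext x
    exact eI_iff_xor_mem _ _
  rw [this]
  exact hx hm

theorem FsigmaIdeal.exists_monotone (hF : FsigmaIdeal I) :
    ∃ C : ℕ → Set (ℕ → Bool), (∀ k, IsClosed (C k)) ∧ Monotone C ∧ chi '' I = ⋃ k, C k := by
  obtain ⟨F, hFc, hF⟩ := hF
  refine ⟨Set.accumulate F, fun k => ?_, Set.monotone_accumulate, ?_⟩
  · exact (Set.finite_le_nat k).isClosed_biUnion fun i _ => hFc i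
  · rw [hF, Set.iUnion_accumulate]

/-- If `x` and `y` are not `E_I`-equivalent, then for any closed set of elements of the ideal, a
finite piece of the difference of `x` and `y`, beyond `N`, does not occur in that closed set. -/
theorem exists_piece (hI : IsIdeal I) {C : Set (ℕ → Bool)} (hC : IsClosed C)
    (hCI : C ⊆ chi '' I) {x y : ℕ → Bool} (hxy : ¬ EI I x y) (N : ℕ) :
    ∃ N', N < N' ∧ ∀ w : ℕ → Bool, (∀ n, N ≤ n → n < N' → w n = xor (x n) (y n)) → w ∉ C := by
  by_contra! hcon
  let K : ℕ → Set (ℕ → Bool) := fun m =>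
    C ∩ {w | ∀ n, N ≤ n → n < N + 1 + m → w n = xor (x n) (y n)}
  have hK : ∀ m, IsClosed (K m) := fun m => by
    refine hC.inter ?_
    simp only [ofPred_forall]
    exact isClosed_iInter fun n => isClosed_iInter fun _ => isClosed_iInter fun _ =>
      isClosed_eq (continuous_apply n) continuous_const
  obtain ⟨w, hw⟩ := IsCompact.nonempty_iInter_of_sequence_nonempty_isCompact_isClosed K
    (fun m w hw => ⟨hw.1, fun n h1 h2 => hw.2 n h1 (by omega)⟩)
    (fun m => by
      obtain ⟨w, hw, hwC⟩ := hcon (N + 1 + m) (by omega)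
      exact ⟨w, hwC, hw⟩) (hK 0).isCompact hK
  have hwn : ∀ n, N ≤ n → w n = xor (x n) (y n) := fun n hn =>
    (mem_iInter.1 hw n).2 n hn (by omega)
  obtain ⟨A, hA, rfl⟩ := hCI (mem_iInter.1 hw 0).1
  refine hxy (hI.2.1 _ (A ∪ Iio N) (fun n hn => ?_) (hI.2.2.1 _ _ hA (hI.1 _ (finite_Iio N))))
  rcases lt_or_ge n N with h | h
  · exact Or.inr h
  · left
    have := hwn n h
    have hn : x n ≠ y n := hn
    have hxor : xor (x n) (y n) = true := by
      cases hx : x n <;> cases hy : y n <;> simp_all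
    rw [hxor] at this
    simpa [chi] using this

end Ideal

theorem apply_eq_of_periodic_two {α : Type*} {z : ℕ → α} (hz : ∀ k, z (k + 2) = z k) (k : ℕ) :
    z k = z (k % 2) := by
  conv_lhs => rw [← Nat.mod_add_div k 2]
  generalize k / 2 = j
  induction j with
  | zero => rfl
  | succ j ih => rw [mul_add, mul_one, ← add_assoc, hz, ih]

section Reduction

variable {I : Set (Set ℕ)} {f : (ℕ → ℕ) → ℕ → Bool}

/-- Below some node, almost every branch only meets nodes whose forced value is equivalent to the
forced values at almost all of their successors. -/
theorem exists_uBig_eventually_eI (hI : IsIdeal I) (hF : FsigmaIdeal I) (hf : Measurable f)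
    (hK : ∀ x y, Krel x y → EI I (f x) (f y)) :
    ∃ r, UBig r {x | ∀ n, r.length ≤ n → ∀ᶠ i in (hyperfilter ℕ : Filter ℕ),
      EI I (forced f (seg x n)) (forced f (seg x n ++ [i]))} := by
  let D : List ℕ → Prop := fun s => ¬ ∀ᶠ i in (hyperfilter ℕ : Filter ℕ),
      EI I (forced f s) (forced f (s ++ [i]))
  by_contra! hcon
  have hbar : ∀ r, UBig r {x | ∃ n, r.length ≤ n ∧ D (seg x n)} := fun r =>
    (uBig_exists_node_or D r).resolve_right fun h => hcon r <| h.mono fun x _ hx n hn =>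
      not_not.1 (hx n hn)
  have hA : UBig [] {x | ∀ m, ∃ n, m ≤ n ∧ D (seg x n)} :=
    (Big.fusion hbar).mono fun x _ hx m => by
      simpa only [mem_ofPred_eq, seg_length] using hx m (Nat.zero_le _)
  obtain ⟨C, hC, hCm, hCI⟩ := hF.exists_monotone
  have hCk : ∀ k, C k ⊆ chi '' I := fun k => hCI ▸ subset_iUnion C k
  obtain ⟨z, N, hz, hKz, hN, -, hzA, -, hR, hfz⟩ := exists_krel_pair_forced hf hA
    (fun _ _ _ => True)
    (fun k s t N i N' => D s → ∀ w : ℕ → Bool, (∀ n, N ≤ n → n < N' →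
      w n = xor (forced f (s ++ [i]) n) (forced f t n)) → w ∉ C k) trivial (by
    intro k s t N _
    by_cases hs : D s
    · by_cases hst : EI I (forced f s) (forced f t)
      · filter_upwards [Ultrafilter.eventually_not.2 hs] with i hi
        obtain ⟨N', hN, hw⟩ := exists_piece hI (hC k) (hCk k)
          (fun h : EI I (forced f (s ++ [i])) (forced f t) => hi (hst.trans hI h.symm)) N
        exact ⟨N', hN, trivial, fun _ => hw⟩
      · obtain ⟨N', hN, hw⟩ := exists_piece hI (hC k) (hCk k) hst N
        filter_upwards [eventually_forced_eq hf s N'] with i hi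
        refine ⟨N', hN, trivial, fun _ w hwn => hw w fun n h1 h2 => ?_⟩
        rw [hwn n h1 h2, hi n h2]
    · exact Eventually.of_forall fun i => ⟨N + 1, by omega, trivial, fun h => absurd h hs⟩)
  have hmem := (eI_iff_xor_mem _ _).1 (hK _ _ hKz)
  rw [hCI] at hmem
  obtain ⟨j, hj⟩ := mem_iUnion.1 hmem
  obtain ⟨n, hjn, hD⟩ := hzA j
  have hz0 : z (2 * n) = z 0 := (apply_eq_of_periodic_two hz _).trans (by simp)
  have hz1 : z (2 * n + 1) = z 1 := (apply_eq_of_periodic_two hz _).trans (by simp [Nat.add_mod])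
  have hz2 : z (2 * n + 2) = z 0 := (hz _).trans hz0
  have hk0 := hfz (2 * n)
  have hk1 := hfz (2 * n + 1)
  have hRn := hR (2 * n)
  simp only [List.length_nil, zero_add, hz0, hz1, hz2, show 2 * n / 2 = n by omega,
    show (2 * n + 1) / 2 = n by omega, show (2 * n + 1 + 1) / 2 = n + 1 by omega, seg_succ]
    at hk0 hk1 hRn
  refine hRn hD _ (fun m _ hm => ?_) (hCm (show j ≤ 2 * n by omega) hj)
  rw [hk0 m hm, hk1 m (hm.trans (hN (Nat.lt_succ_self _)))]

/-- Below some node, almost every branch belongs to one fixed class. -/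
theorem exists_uBig_eI (hI : IsIdeal I) (hP : IsPIdeal I) (hF : FsigmaIdeal I) (hf : Measurable f)
    (hK : ∀ x y, Krel x y → EI I (f x) (f y)) :
    ∃ r, UBig r {x | EI I (f x) (forced f r)} := by
  classical
  obtain ⟨r, hr⟩ := exists_uBig_eventually_eI hI hF hf hK
  set A := {x | ∀ n, r.length ≤ n → ∀ᶠ i in (hyperfilter ℕ : Filter ℕ),
      EI I (forced f (seg x n)) (forced f (seg x n ++ [i]))} with hAdef
  refine ⟨r, (uBig_or_uBig_compl (measurableSet_eI hF hf (forced f r)) r).resolve_right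
    fun hcon => ?_⟩
  have hAs : ∀ s, r.length ≤ s.length → UBig s A → ∀ᶠ i in (hyperfilter ℕ : Filter ℕ),
      EI I (forced f s) (forced f (s ++ [i])) := fun s hs hA => by
    obtain ⟨x, hx, hxs⟩ := hA.exists
    have := hx s.length hs
    rwa [hxs] at this
  obtain ⟨B, hBI, hB⟩ := hP (fun n => (Encodable.decode (α := List ℕ) n).elim ∅ fun s =>
    if EI I (forced f s) (forced f r) then {m | forced f s m ≠ forced f r m} else ∅) (fun n => by
      cases Encodable.decode (α := List ℕ) n with
      | none => exact hI.1 _ finite_empty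
      | some s =>
        by_cases h : EI I (forced f s) (forced f r)
        · simp only [Option.elim_some, if_pos h]
          exact h
        · simpa only [Option.elim_some, if_neg h] using hI.1 _ finite_empty)
  have hBs : ∀ s, EI I (forced f s) (forced f r) →
      ∃ N, ∀ n, N ≤ n → forced f s n ≠ forced f r n → n ∈ B := fun s hs => by
    have := hB (Encodable.encode s)
    simp only [Encodable.encodek, Option.elim_some, if_pos hs] at this
    obtain ⟨N, hN⟩ := this.bddAbove
    refine ⟨N + 1, fun n hn hne => ?_⟩
    by_contra hnB
    have : n ≤ N := hN ⟨hne, hnB⟩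
    omega
  let Inv : List ℕ → Prop := fun s =>
    r.length ≤ s.length ∧ UBig s A ∧ EI I (forced f s) (forced f r)
  have hInv : Inv r := ⟨le_rfl, hr, EI.refl hI _⟩
  obtain ⟨z, N, hz, hKz, hN, hN0, hzA, hI', -, hfz⟩ := exists_krel_pair_forced hf hcon
    (fun s t N => Inv s ∧ Inv t ∧ ∀ n, N ≤ n → forced f t n ≠ forced f r n → n ∈ B)
    (fun _ _ _ _ _ _ => True) ⟨hInv, hInv, fun n _ h => absurd rfl h⟩ (by
    rintro k s t N ⟨hs, ht, -⟩
    filter_upwards [hAs s hs.1 hs.2.1, hs.2.1.children] with i hi hAi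
    have hsi : EI I (forced f (s ++ [i])) (forced f r) := hi.symm.trans hI hs.2.2
    obtain ⟨N', hN'⟩ := hBs _ hsi
    exact ⟨max (N + 1) N', lt_of_lt_of_le (Nat.lt_succ_self N) (le_max_left _ _),
      ⟨ht, ⟨by simpa using hs.1.trans (Nat.le_succ _), hAi, hsi⟩,
        fun n hn => hN' n (le_trans (le_max_right _ _) hn)⟩, trivial⟩)
  refine hzA (hI.2.1 _ (B ∪ {n | f (z 0) n ≠ f (z 1) n}) (fun n hn => ?_)
    (hI.2.2.1 _ _ hBI (hK _ _ hKz)))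
  have hex : ∃ k, n < N (k + 1) := ⟨n, (Nat.lt_succ_self n).trans_le (hN.le_apply)⟩
  obtain ⟨k, hNk, hk⟩ : ∃ k, N k ≤ n ∧ n < N (k + 1) := by
    refine ⟨Nat.find hex, ?_, Nat.find_spec hex⟩
    rcases h : Nat.find hex with _ | k
    · simp [hN0]
    · exact not_lt.1 (Nat.find_min hex (h ▸ Nat.lt_succ_self k))
  by_cases hne : f (z (k + 1)) n = forced f r n
  · refine Or.inr fun h01 => hn ?_
    rw [← hne, apply_eq_of_periodic_two hz (k + 1)]
    rcases Nat.mod_two_eq_zero_or_one (k + 1) with h | h <;> rw [h]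
    exact h01
  · rw [hfz k n hk] at hne
    exact Or.inl ((hI' k).2.2 n hNk hne)

end Reduction

/-- an equivalence relation containing `K` and Borel reducible to
`E_I` for an F_σ P-ideal `I` has a single class whose complement is in the
Laver ideal; in particular this class contains all branches of a Laver tree. -/
theorem stmt13 (I : Set (Set ℕ)) (hI : IsIdeal I) (hP : IsPIdeal I) (hF : FsigmaIdeal I)
    (E : (ℕ → ℕ) → (ℕ → ℕ) → Prop) (hE : Equivalence E)
    (hK : ∀ x y, Krel x y → E x y)
    (f : (ℕ → ℕ) → (ℕ → Bool)) (hf : Measurable f)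
    (hred : ∀ x y, E x y ↔ EI I (f x) (f y)) :
    ∃ X : Set (ℕ → ℕ), (∃ x, X = {y | E x y}) ∧ InLaverIdeal Xᶜ ∧
      ∃ T, IsLaverTree T ∧ branches T ⊆ X := by
  have hK' : ∀ x y, Krel x y → EI I (f x) (f y) := fun x y h => (hred x y).1 (hK x y h)
  obtain ⟨r, hr⟩ := exists_uBig_eI hI hP hF hf hK'
  obtain ⟨x₀, hx₀, -⟩ := hr.exists
  have hX : {y | E x₀ y} = {y | EI I (f y) (f x₀)} := by
    ext y
    exact (hred x₀ y).trans ⟨EI.symm, EI.symm⟩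
  have hXm : MeasurableSet {y | E x₀ y} := hX ▸ measurableSet_eI hF hf (f x₀)
  have hXr : UBig r {y | E x₀ y} := hr.mono fun y _ hy =>
    (hred x₀ y).2 (EI.trans hI hx₀ (EI.symm hy))
  have hco : ∀ s, CoBig s {y | E x₀ y} := fun s => by
    by_contra hs
    obtain ⟨u, hu, hu', hbig⟩ := exists_big_of_not_coBig_compl hXm.compl (by rwa [compl_compl])
    obtain ⟨x, hx, y, hy, hxy⟩ := Big.exists_krel (fun _ => Nat.hyperfilter_le_atTop) hu' hXr hbig
    exact hy (hE.trans hx (hK x y hxy))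
  exact ⟨{y | E x₀ y}, ⟨x₀, rfl⟩,
    inLaverIdeal_of_coBig_compl fun s => by simpa only [compl_compl] using hco s,
    exists_laverTree_of_coBig (hco [])⟩
end

section
/- The relation K is an equivalence relation on ℕ^ℕ (reflexive, symmetric and transitive), and K, viewed as a subset of ℕ^ℕ × ℕ^ℕ, is an F_σ set (a countable union of closed sets). -/
open Set Filter

/-- The set of pairs related by `Krel` with the fixed bound `b` is closed. -/
theorem isClosed_setOf_krel_bound (b : ℕ) :
    IsClosed {q : (ℕ → ℕ) × (ℕ → ℕ) | ∀ n : ℕ, ∃ mx ≤ b, ∃ my ≤ b,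
      q.1 n ≤ q.2 (n + my) ∧ q.2 n ≤ q.1 (n + mx)} := by
  have h : {q : (ℕ → ℕ) × (ℕ → ℕ) | ∀ n : ℕ, ∃ mx ≤ b, ∃ my ≤ b,
      q.1 n ≤ q.2 (n + my) ∧ q.2 n ≤ q.1 (n + mx)} =
      ⋂ n : ℕ, ⋃ mx ∈ Set.Iic b, ⋃ my ∈ Set.Iic b,
        {q | q.1 n ≤ q.2 (n + my) ∧ q.2 n ≤ q.1 (n + mx)} := by
    ext q
    simp only [mem_ofPred_eq, mem_iInter, mem_iUnion, mem_Iic, exists_prop]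
  rw [h]
  refine isClosed_iInter fun n => (Set.finite_Iic b).isClosed_biUnion fun mx _ =>
    (Set.finite_Iic b).isClosed_biUnion fun my _ => ?_
  have hle (i j : ℕ) : IsClosed {q : (ℕ → ℕ) × (ℕ → ℕ) | q.1 i ≤ q.2 j} :=
    isClosed_le (by fun_prop) (by fun_prop)
  have hge (i j : ℕ) : IsClosed {q : (ℕ → ℕ) × (ℕ → ℕ) | q.2 i ≤ q.1 j} :=
    isClosed_le (by fun_prop) (by fun_prop)
  exact (hle n (n + my)).inter (hge n (n + mx))

/-- `Krel` is an equivalence relation. -/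
theorem equivalence_krel : Equivalence Krel where
  refl x := ⟨0, fun n => ⟨0, le_rfl, 0, le_rfl, le_rfl, le_rfl⟩⟩
  symm := by
    rintro x y ⟨b, hb⟩
    refine ⟨b, fun n => ?_⟩
    obtain ⟨mx, hmx, my, hmy, hxy, hyx⟩ := hb n
    exact ⟨my, hmy, mx, hmx, hyx, hxy⟩
  trans := by
    rintro x y z ⟨b, hb⟩ ⟨c, hc⟩
    refine ⟨b + c, fun n => ?_⟩
    obtain ⟨_, _, my, hmy, hxy, _⟩ := hb n
    obtain ⟨_, _, mz, hmz, hyz, _⟩ := hc (n + my)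
    obtain ⟨my', hmy', _, _, _, hzy⟩ := hc n
    obtain ⟨mx, hmx, _, _, _, hyx⟩ := hb (n + my')
    refine ⟨my' + mx, by lia, my + mz, by lia, ?_, ?_⟩
    · rw [← add_assoc]
      exact hxy.trans hyz
    · rw [← add_assoc]
      exact hzy.trans hyx

/-- `K` is an F_σ equivalence relation on the Baire space. -/
theorem stmt14 :
    Equivalence Krel ∧ IsFsigma {q : (ℕ → ℕ) × (ℕ → ℕ) | Krel q.1 q.2} := by
  refine ⟨equivalence_krel, _, isClosed_setOf_krel_bound, ?_⟩
  ext q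
  simp [Krel]
end

section
/- The equivalence relation E₂ on 2^ℕ is Borel bireducible with the equivalence relation E_{ℓ¹} on ℝ^ℕ. -/
open Set Filter

/-- The equivalence `E₂` on the Cantor space. -/
def E2 (x y : ℕ → Bool) : Prop :=
  ∑' n : {n | x n ≠ y n}, (1 : ENNReal) / ((n : ℕ) + 1) < ⊤

/-- The equivalence `E_{ℓ¹}` on `ℝ^ℕ`. -/
def El1 (x y : ℕ → ℝ) : Prop := Summable fun n => |x n - y n|

theorem E2_iff_tsum_ne_top (x y : ℕ → Bool) :
    E2 x y ↔ ∑' n : ℕ, (if x n ≠ y n then (1 : ENNReal) / ((n : ℕ) + 1) else 0) ≠ ⊤ := by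
  unfold E2
  rw [lt_top_iff_ne_top, tsum_subtype {n | x n ≠ y n} (fun n : ℕ => (1 : ENNReal) / ((n : ℕ) + 1))]
  simp only [indicator_apply, mem_ofPred_eq]

theorem tsum_ofReal_ne_top_iff_summable {ι : Type*} {f : ι → ℝ} (hf : ∀ i, 0 ≤ f i) :
    ∑' i, ENNReal.ofReal (f i) ≠ ⊤ ↔ Summable f :=
  ⟨fun h => (ENNReal.summable_toReal h).congr fun i => ENNReal.toReal_ofReal (hf i),
    fun h => h.tsum_ofReal_ne_top⟩

theorem El1_iff_tsum_ne_top (x y : ℕ → ℝ) :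
    El1 x y ↔ ∑' n : ℕ, ENNReal.ofReal |x n - y n| ≠ ⊤ :=
  Iff.symm <| tsum_ofReal_ne_top_iff_summable fun _ => abs_nonneg _

/-- The real sequence `n ↦ x n / (n + 1)`. -/
noncomputable def harmonicWeight (x : ℕ → Bool) (n : ℕ) : ℝ :=
  if x n then 1 / ((n : ℝ) + 1) else 0

theorem measurable_harmonicWeight : Measurable harmonicWeight := by
  refine measurable_pi_lambda _ fun n => ?_
  exact (measurable_of_countable fun b : Bool => if b then 1 / ((n : ℝ) + 1) else 0).comp
    (measurable_pi_apply n)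

theorem E2_iff_El1_harmonicWeight (x y : ℕ → Bool) :
    E2 x y ↔ El1 (harmonicWeight x) (harmonicWeight y) := by
  rw [E2_iff_tsum_ne_top, El1_iff_tsum_ne_top]
  have h : ∀ n : ℕ, ENNReal.ofReal |harmonicWeight x n - harmonicWeight y n| =
      if x n ≠ y n then (1 : ENNReal) / ((n : ℕ) + 1) else 0 := by
    intro n
    have hpos : (0 : ℝ) < (n : ℝ) + 1 := by positivity
    have hval : ENNReal.ofReal (1 / ((n : ℝ) + 1)) = 1 / ((n : ENNReal) + 1) := by
      rw [ENNReal.ofReal_div_of_pos hpos, ENNReal.ofReal_add (by positivity) zero_le_one]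
      simp
    have habs : |1 / ((n : ℝ) + 1)| = 1 / ((n : ℝ) + 1) := abs_of_pos (by positivity)
    unfold harmonicWeight
    cases x n <;> cases y n <;> simp [-one_div, habs, hval]
  simp only [h]

/-- The thermometer code of a real sequence: the cut `j / 2 ^ n` of the `n`-th coordinate, with
`(n, j)` coded by `k`, is recorded on the `2 ^ (k - n)` first positions `m` such that
`2 ^ k ≤ m + 1`. -/
noncomputable def thermometer (x : ℕ → ℝ) (m : ℕ) : Bool :=
  let k := Nat.log 2 (m + 1)
  let n := k.unpair.1
  decide (m + 1 < 2 ^ k + 2 ^ (k - n) ∧ Equiv.intEquivNat.symm k.unpair.2 ≤ ⌊2 ^ n * x n⌋)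

theorem measurable_thermometer : Measurable thermometer := by
  refine measurable_pi_lambda _ fun m => ?_
  set k := Nat.log 2 (m + 1)
  have h : Measurable fun x : ℕ → ℝ => ⌊2 ^ k.unpair.1 * x k.unpair.1⌋ :=
    ((measurable_pi_apply _).const_mul _).floor
  exact (measurable_of_countable fun z : ℤ => decide (m + 1 < 2 ^ k + 2 ^ (k - k.unpair.1) ∧
    Equiv.intEquivNat.symm k.unpair.2 ≤ z)).comp h

/-- The harmonic weight of the `2 ^ (k - n)` first positions `m` such that `2 ^ k ≤ m + 1`. -/
noncomputable def blockWeight (k n : ℕ) : ENNReal :=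
  ∑' m : ℕ, if Nat.log 2 (m + 1) = k ∧ m + 1 < 2 ^ k + 2 ^ (k - n)
    then (1 : ENNReal) / ((m : ℕ) + 1) else 0

theorem blockWeight_eq_sum (k n : ℕ) :
    blockWeight k n = ∑ r ∈ Finset.range (2 ^ (k - n)), ((2 ^ k + r : ℕ) : ENNReal)⁻¹ := by
  have hk : 0 < 2 ^ k := by positivity
  have hle : 2 ^ (k - n) ≤ 2 ^ k := Nat.pow_le_pow_right (by norm_num) (Nat.sub_le _ _)
  have hmem : ∀ m : ℕ, (Nat.log 2 (m + 1) = k ∧ m + 1 < 2 ^ k + 2 ^ (k - n)) ↔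
      m ∈ Finset.Ico (2 ^ k - 1) (2 ^ k - 1 + 2 ^ (k - n)) := by
    intro m
    rw [Finset.mem_Ico, Nat.log_eq_iff (Or.inr ⟨by norm_num, by omega⟩), pow_succ]
    omega
  unfold blockWeight
  simp only [hmem]
  rw [tsum_eq_sum (s := Finset.Ico (2 ^ k - 1) (2 ^ k - 1 + 2 ^ (k - n)))
    (fun m hm => if_neg hm), Finset.sum_Ico_eq_sum_range]
  refine Finset.sum_congr (by rw [Nat.add_sub_cancel_left]) fun r hr => ?_
  rw [Finset.mem_range] at hr
  rw [if_pos (Finset.mem_Ico.2 ⟨by omega, by omega⟩ :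
    2 ^ k - 1 + r ∈ Finset.Ico (2 ^ k - 1) (2 ^ k - 1 + 2 ^ (k - n))), one_div]
  congr 1
  have : 2 ^ k + r = (2 ^ k - 1 + r) + 1 := by omega
  rw [this]
  push_cast
  rfl

theorem two_pow_sub_mul_inv {k n : ℕ} (h : n ≤ k) :
    (2 : ENNReal) ^ (k - n) * (2 ^ k)⁻¹ = (2 ^ n)⁻¹ := by
  obtain ⟨d, rfl⟩ := Nat.exists_eq_add_of_le h
  rw [Nat.add_sub_cancel_left, pow_add, ENNReal.mul_inv (by simp) (by simp), mul_left_comm,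
    ENNReal.mul_inv_cancel (by simp) (by simp), mul_one]

theorem blockWeight_le {k n : ℕ} (h : n ≤ k) : blockWeight k n ≤ (2 ^ n)⁻¹ := by
  rw [blockWeight_eq_sum, ← two_pow_sub_mul_inv h]
  refine (Finset.sum_le_card_nsmul _ _ ((2 ^ k)⁻¹) fun r _ => ?_).trans (by simp)
  rw [ENNReal.inv_le_inv]
  push_cast
  exact le_self_add

theorem le_two_mul_blockWeight {k n : ℕ} (h : n ≤ k) : (2 ^ n)⁻¹ ≤ 2 * blockWeight k n := by
  rw [blockWeight_eq_sum, ← two_pow_sub_mul_inv h, Finset.mul_sum]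
  refine le_trans (by simp) (Finset.card_nsmul_le_sum _ _ ((2 ^ k)⁻¹) fun r hr => ?_)
  rw [Finset.mem_range] at hr
  have hle : 2 ^ (k - n) ≤ 2 ^ k := Nat.pow_le_pow_right (by norm_num) (Nat.sub_le _ _)
  have h2 : ((2 ^ k + r : ℕ) : ENNReal) ≤ 2 * 2 ^ k := by
    exact_mod_cast (by omega : 2 ^ k + r ≤ 2 * 2 ^ k)
  calc ((2 : ENNReal) ^ k)⁻¹ = 2 * (2 * 2 ^ k)⁻¹ := by
        rw [ENNReal.mul_inv (by simp) (by simp), ← mul_assoc,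
          ENNReal.mul_inv_cancel (by simp) (by simp), one_mul]
    _ ≤ _ := by gcongr

theorem tsum_thermometer_ne (x y : ℕ → ℝ) :
    ∑' m : ℕ, (if thermometer x m ≠ thermometer y m then (1 : ENNReal) / ((m : ℕ) + 1) else 0) =
      ∑' k : ℕ, if (Equiv.intEquivNat.symm k.unpair.2 ≤ ⌊2 ^ k.unpair.1 * x k.unpair.1⌋ ↔
        Equiv.intEquivNat.symm k.unpair.2 ≤ ⌊2 ^ k.unpair.1 * y k.unpair.1⌋) then 0
        else blockWeight k k.unpair.1 := by
  have h : ∀ m : ℕ,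
      (if thermometer x m ≠ thermometer y m then (1 : ENNReal) / ((m : ℕ) + 1) else 0) =
      ∑' k : ℕ, if Nat.log 2 (m + 1) = k then
        (if thermometer x m ≠ thermometer y m then (1 : ENNReal) / ((m : ℕ) + 1) else 0)
        else 0 := by
    intro m
    rw [tsum_eq_single (Nat.log 2 (m + 1)) (fun k hk => if_neg (Ne.symm hk)), if_pos rfl]
  rw [tsum_congr h, ENNReal.tsum_comm]
  refine tsum_congr fun k => ?_
  split_ifs with hxy
  · rw [ENNReal.tsum_eq_zero]
    intro m
    split_ifs with hm hne
    · subst hm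
      simp [thermometer, hxy] at hne
    all_goals rfl
  · refine tsum_congr fun m => ?_
    by_cases hm : Nat.log 2 (m + 1) = k
    · subst hm
      by_cases hlt : m + 1 < 2 ^ Nat.log 2 (m + 1) +
          2 ^ (Nat.log 2 (m + 1) - (Nat.log 2 (m + 1)).unpair.1)
      · have : thermometer x m ≠ thermometer y m := by simpa [thermometer, hlt] using hxy
        simp [this, hlt]
      · simp [thermometer, hlt]
    · simp [hm]

theorem tsum_cuts_between (a b : ℤ) (c : ENNReal) :
    ∑' j : ℤ, (if (j ≤ a ↔ j ≤ b) then 0 else c) = c * ENNReal.ofReal |(a : ℝ) - b| := by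
  wlog hab : a ≤ b generalizing a b
  · rw [abs_sub_comm, ← this b a (by omega)]
    simp only [Iff.comm]
  have hmem : ∀ j : ℤ, (if (j ≤ a ↔ j ≤ b) then 0 else c) =
      if j ∈ Finset.Ioc a b then c else 0 := by
    intro j
    simp only [Finset.mem_Ioc]
    split_ifs <;> first | rfl | (exfalso; omega)
  rw [tsum_congr hmem, tsum_eq_sum (s := Finset.Ioc a b) (fun j hj => if_neg hj),
    Finset.sum_congr rfl (fun j hj => if_pos hj), Finset.sum_const, Int.card_Ioc, nsmul_eq_mul,
    mul_comm, ← ENNReal.ofReal_natCast]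
  congr 2
  have hcast : (((b - a).toNat : ℤ) : ℝ) = b - a := by
    rw [Int.toNat_of_nonneg (by omega)]; push_cast; rfl
  have habR : (a : ℝ) ≤ b := by exact_mod_cast hab
  rw [abs_of_nonpos (by linarith), neg_sub, ← hcast, Int.cast_natCast]

theorem abs_floor_sub_floor_le (u v : ℝ) : |(⌊u⌋ : ℝ) - ⌊v⌋| ≤ |u - v| + 1 := by
  have := Int.floor_le u
  have := Int.lt_floor_add_one u
  have := Int.floor_le v
  have := Int.lt_floor_add_one v
  have := le_abs_self (u - v)
  have := neg_abs_le (u - v)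
  rw [abs_le]
  constructor <;> linarith

theorem abs_sub_le_abs_floor_sub_floor (u v : ℝ) : |u - v| ≤ |(⌊u⌋ : ℝ) - ⌊v⌋| + 1 := by
  have := Int.floor_le u
  have := Int.lt_floor_add_one u
  have := Int.floor_le v
  have := Int.lt_floor_add_one v
  have := le_abs_self ((⌊u⌋ : ℝ) - ⌊v⌋)
  have := neg_abs_le ((⌊u⌋ : ℝ) - ⌊v⌋)
  rw [abs_le]
  constructor <;> linarith

theorem E2_thermometer_iff_tsum_floor (x y : ℕ → ℝ) :
    E2 (thermometer x) (thermometer y) ↔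
      ∑' n : ℕ, ((2 : ENNReal) ^ n)⁻¹ *
        ENNReal.ofReal |(⌊2 ^ n * x n⌋ : ℝ) - ⌊2 ^ n * y n⌋| ≠ ⊤ := by
  have hsum : ∑' n : ℕ, ((2 : ENNReal) ^ n)⁻¹ *
        ENNReal.ofReal |(⌊2 ^ n * x n⌋ : ℝ) - ⌊2 ^ n * y n⌋| =
      ∑' k : ℕ, if (Equiv.intEquivNat.symm k.unpair.2 ≤ ⌊2 ^ k.unpair.1 * x k.unpair.1⌋ ↔
        Equiv.intEquivNat.symm k.unpair.2 ≤ ⌊2 ^ k.unpair.1 * y k.unpair.1⌋) then 0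
        else ((2 : ENNReal) ^ k.unpair.1)⁻¹ := by
    simp only [← tsum_cuts_between]
    rw [← ENNReal.tsum_prod (f := fun (n : ℕ) (j : ℤ) =>
      if (j ≤ ⌊2 ^ n * x n⌋ ↔ j ≤ ⌊2 ^ n * y n⌋) then 0 else ((2 : ENNReal) ^ n)⁻¹)]
    exact ((Nat.pairEquiv.symm.trans
      ((Equiv.refl ℕ).prodCongr Equiv.intEquivNat.symm)).tsum_eq _).symm
  rw [E2_iff_tsum_ne_top, tsum_thermometer_ne, hsum]
  constructor
  · intro h
    refine ne_top_of_le_ne_top (ENNReal.mul_ne_top (ENNReal.ofNat_ne_top (n := 2)) h) ?_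
    rw [← ENNReal.tsum_mul_left]
    refine ENNReal.tsum_le_tsum fun k => ?_
    split_ifs
    · simp
    · exact le_two_mul_blockWeight (Nat.unpair_left_le k)
  · intro h
    refine ne_top_of_le_ne_top h (ENNReal.tsum_le_tsum fun k => ?_)
    split_ifs
    · exact le_rfl
    · exact blockWeight_le (Nat.unpair_left_le k)

theorem inv_two_pow_mul_ofReal (n : ℕ) (r : ℝ) :
    ((2 : ENNReal) ^ n)⁻¹ * ENNReal.ofReal r = ENNReal.ofReal ((2 ^ n)⁻¹ * r) := by
  rw [ENNReal.ofReal_mul (by positivity), ENNReal.ofReal_inv_of_pos (by positivity),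
    ENNReal.ofReal_pow (by norm_num)]
  simp

theorem El1_iff_E2_thermometer (x y : ℕ → ℝ) :
    El1 x y ↔ E2 (thermometer x) (thermometer y) := by
  rw [E2_thermometer_iff_tsum_floor]
  simp only [inv_two_pow_mul_ofReal]
  rw [tsum_ofReal_ne_top_iff_summable (fun _ => by positivity)]
  have hgeom : Summable fun n : ℕ => ((2 : ℝ) ^ n)⁻¹ := by
    simpa using summable_geometric_two
  have hscale : ∀ n : ℕ, |x n - y n| = (2 ^ n)⁻¹ * |2 ^ n * x n - 2 ^ n * y n| := by
    intro n
    rw [← mul_sub, abs_mul, abs_of_pos (by positivity : (0 : ℝ) < 2 ^ n),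
      inv_mul_cancel_left₀ (by positivity)]
  unfold El1
  constructor <;> intro h <;>
    refine Summable.of_nonneg_of_le (fun _ => by positivity) (fun n => ?_) (h.add hgeom) <;>
    rw [hscale n, ← mul_add_one]
  · gcongr
    exact abs_floor_sub_floor_le _ _
  · gcongr
    exact abs_sub_le_abs_floor_sub_floor _ _

/-- `E₂` is Borel bireducible with `E_{ℓ¹}`. -/
theorem stmt17 :
    (∃ f : (ℕ → Bool) → (ℕ → ℝ), Measurable f ∧
        ∀ x y, (E2 x y ↔ El1 (f x) (f y))) ∧
      (∃ g : (ℕ → ℝ) → (ℕ → Bool), Measurable g ∧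
        ∀ x y, (El1 x y ↔ E2 (g x) (g y))) := by
  exact ⟨⟨harmonicWeight, measurable_harmonicWeight, E2_iff_El1_harmonicWeight⟩,
    ⟨thermometer, measurable_thermometer, El1_iff_E2_thermometer⟩⟩
end
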